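/- For each fixed t ∈ ℝ, the inverse matrix E(x,t)⁻¹ tends to the zero matrix as x → +∞ and as x → −∞. -/

import Mathlib

open Matrix MeasureTheory Filter

noncomputable def mexp {p : ℕ} (M : Matrix (Fin p) (Fin p) ℝ) : Matrix (Fin p) (Fin p) ℝ :=
  ∑' k : ℕ, (k.factorial : ℝ)⁻¹ • M ^ k

def EigPos {p : ℕ} (A : Matrix (Fin p) (Fin p) ℝ) : Prop :=
  ∀ μ ∈ spectrum ℂ (A.map Complex.ofReal), 0 < μ.re

def Observable {p : ℕ} (A : Matrix (Fin p) (Fin p) ℝ) (C : Matrix (Fin 1) (Fin p) ℝ) : Prop :=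
  ∀ v : Fin p → ℝ, (∀ r : ℕ, (C * A ^ r) *ᵥ v = 0) → v = 0

def Controllable {p : ℕ} (A : Matrix (Fin p) (Fin p) ℝ) (B : Matrix (Fin p) (Fin 1) ℝ) : Prop :=
  ∀ v : Fin p → ℝ, (∀ r : ℕ, (Bᵀ * Aᵀ ^ r) *ᵥ v = 0) → v = 0

noncomputable def Qmat {p : ℕ} (A : Matrix (Fin p) (Fin p) ℝ) (C : Matrix (Fin 1) (Fin p) ℝ) :
    Matrix (Fin p) (Fin p) ℝ :=
  Matrix.of fun i j =>
    ∫ s in Set.Ioi (0 : ℝ), (mexp (-(s • Aᵀ)) * (Cᵀ * C) * mexp (-(s • A))) i j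

noncomputable def Nmat {p : ℕ} (A : Matrix (Fin p) (Fin p) ℝ) (B : Matrix (Fin p) (Fin 1) ℝ) :
    Matrix (Fin p) (Fin p) ℝ :=
  Matrix.of fun i j =>
    ∫ s in Set.Ioi (0 : ℝ), (mexp (-(s • A)) * (B * Bᵀ) * mexp (-(s • Aᵀ))) i j

noncomputable def Pmat {p : ℕ} (A : Matrix (Fin p) (Fin p) ℝ) (B : Matrix (Fin p) (Fin 1) ℝ)
    (C : Matrix (Fin 1) (Fin p) ℝ) : Matrix (Fin p) (Fin p) ℝ :=
  Matrix.of fun i j =>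
    ∫ s in Set.Ioi (0 : ℝ), (mexp (-(s • A)) * (B * C) * mexp (-(s • A))) i j

noncomputable def Fmat {p : ℕ} (A : Matrix (Fin p) (Fin p) ℝ) (B : Matrix (Fin p) (Fin 1) ℝ)
    (C : Matrix (Fin 1) (Fin p) ℝ) (x t : ℝ) : Matrix (Fin p) (Fin p) ℝ :=
  mexp ((2 * x) • Aᵀ - (8 * t) • Aᵀ ^ 3) +
    Qmat A C * mexp (-((2 * x) • A) + (8 * t) • A ^ 3) * Nmat A B

noncomputable def Emat {p : ℕ} (A : Matrix (Fin p) (Fin p) ℝ) (B : Matrix (Fin p) (Fin 1) ℝ)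
    (C : Matrix (Fin 1) (Fin p) ℝ) (x t : ℝ) : Matrix (Fin p) (Fin p) ℝ :=
  mexp ((2 * x) • A - (8 * t) • A ^ 3) +
    Pmat A B C * mexp (-((2 * x) • A) + (8 * t) • A ^ 3) * Pmat A B C

noncomputable def uFun {p : ℕ} (A : Matrix (Fin p) (Fin p) ℝ) (B : Matrix (Fin p) (Fin 1) ℝ)
    (C : Matrix (Fin 1) (Fin p) ℝ) (x t : ℝ) : ℝ :=
  -2 * ((Bᵀ * (Fmat A B C x t)⁻¹ * Cᵀ : Matrix (Fin 1) (Fin 1) ℝ) 0 0)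

noncomputable def vFun {p : ℕ} (A : Matrix (Fin p) (Fin p) ℝ) (B : Matrix (Fin p) (Fin 1) ℝ)
    (C : Matrix (Fin 1) (Fin p) ℝ) (x t : ℝ) : ℝ :=
  -2 * ((C * (Emat A B C x t)⁻¹ * B : Matrix (Fin 1) (Fin 1) ℝ) 0 0)

noncomputable def calQ {p : ℕ} (A : Matrix (Fin p) (Fin p) ℝ) (C : Matrix (Fin 1) (Fin p) ℝ)
    (x t : ℝ) : Matrix (Fin p) (Fin p) ℝ :=
  mexp (-(x • Aᵀ)) * mexp ((8 * t) • Aᵀ ^ 3) * Qmat A C * mexp (-(x • A)) * mexp ((8 * t) • A ^ 3)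

noncomputable def calN {p : ℕ} (A : Matrix (Fin p) (Fin p) ℝ) (B : Matrix (Fin p) (Fin 1) ℝ)
    (x : ℝ) : Matrix (Fin p) (Fin p) ℝ :=
  mexp (-(x • A)) * Nmat A B * mexp (-(x • Aᵀ))

noncomputable def Gam {p : ℕ} (A : Matrix (Fin p) (Fin p) ℝ) (B : Matrix (Fin p) (Fin 1) ℝ)
    (C : Matrix (Fin 1) (Fin p) ℝ) (x t : ℝ) : Matrix (Fin p) (Fin p) ℝ :=
  1 + calQ A C x t * calN A B x

noncomputable def Om {p : ℕ} (A : Matrix (Fin p) (Fin p) ℝ) (B : Matrix (Fin p) (Fin 1) ℝ)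
    (C : Matrix (Fin 1) (Fin p) ℝ) (w t : ℝ) : ℝ :=
  ((C * mexp (-(w • A)) * mexp ((8 * t) • A ^ 3) * B : Matrix (Fin 1) (Fin 1) ℝ) 0 0)

noncomputable def Kker {p : ℕ} (A : Matrix (Fin p) (Fin p) ℝ) (B : Matrix (Fin p) (Fin 1) ℝ)
    (C : Matrix (Fin 1) (Fin p) ℝ) (x y t : ℝ) : ℝ :=
  ((Bᵀ * (Fmat A B C x t)⁻¹ * mexp (-((y - x) • Aᵀ)) * Cᵀ : Matrix (Fin 1) (Fin 1) ℝ) 0 0)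

section normed
open scoped Matrix.Norms.Operator

theorem mat_deriv {p : ℕ} (A : Matrix (Fin p) (Fin p) ℝ) (t : ℝ) :
    HasDerivAt (fun s : ℝ => NormedSpace.exp (s • A)) (A * NormedSpace.exp (t • A)) t := by
  exact hasDerivAt_exp_smul_const' A t

theorem mat_deriv' {p : ℕ} (A : Matrix (Fin p) (Fin p) ℝ) (t : ℝ) :
    HasDerivAt (fun s : ℝ => NormedSpace.exp (s • A)) (NormedSpace.exp (t • A) * A) t := by
  exact hasDerivAt_exp_smul_const A t

theorem mat_hasSum {p : ℕ} (A : Matrix (Fin p) (Fin p) ℂ) :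
    HasSum (fun n : ℕ => ((n.factorial : ℂ)⁻¹) • A ^ n) (NormedSpace.exp A) := by
  exact NormedSpace.exp_series_hasSum_exp' A

theorem mat_map_exp {p : ℕ} (A : Matrix (Fin p) (Fin p) ℝ) :
    (NormedSpace.exp A).map Complex.ofReal = NormedSpace.exp (A.map Complex.ofReal) := by
  have h := NormedSpace.map_exp (𝔸 := Matrix (Fin p) (Fin p) ℝ) (𝔹 := Matrix (Fin p) (Fin p) ℂ)
    (Complex.ofRealHom.mapMatrix) (by
      show Continuous fun M : Matrix (Fin p) (Fin p) ℝ => M.map Complex.ofReal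
      exact Continuous.matrix_map continuous_id Complex.continuous_ofReal) A
  exact h

theorem mexp_eq {p : ℕ} (A : Matrix (Fin p) (Fin p) ℝ) : mexp A = NormedSpace.exp A := by
  rw [mexp, NormedSpace.exp_eq_tsum ℝ]

theorem prod_deriv {p : ℕ} (A K : Matrix (Fin p) (Fin p) ℝ) (t : ℝ) :
    HasDerivAt (fun s : ℝ => NormedSpace.exp (-(s • A)) * K * NormedSpace.exp (-(s • A)))
      (-(A * (NormedSpace.exp (-(t • A)) * K * NormedSpace.exp (-(t • A))) +
        (NormedSpace.exp (-(t • A)) * K * NormedSpace.exp (-(t • A))) * A)) t := by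
  have h1 := mat_deriv (-A) t
  have h2 := mat_deriv' (-A) t
  have h3 := (h1.mul_const K).mul h2
  simp only [smul_neg] at h3
  convert! h3 using 1
  noncomm_ring

theorem inv_tendsto_one {p : ℕ} {l : Filter ℝ} {f : ℝ → Matrix (Fin p) (Fin p) ℝ}
    (hf : Tendsto f l (nhds 1)) : Tendsto (fun x => (f x)⁻¹) l (nhds 1) := by
  have h1 : Tendsto (fun x => (f x).det) l (nhds (1 : Matrix (Fin p) (Fin p) ℝ).det) :=
    ((Continuous.matrix_det continuous_id).tendsto _).comp hf
  have h2 : Tendsto (fun x => (f x).adjugate) l (nhds (1 : Matrix (Fin p) (Fin p) ℝ).adjugate) :=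
    ((Continuous.matrix_adjugate continuous_id).tendsto _).comp hf
  rw [Matrix.det_one] at h1
  rw [Matrix.adjugate_one] at h2
  have h3 := (h1.inv₀ one_ne_zero).smul h2
  simp only [inv_one, one_smul] at h3
  refine h3.congr fun x => ?_
  rw [Matrix.inv_def, Ring.inverse_eq_inv']

theorem lim_lemma {p : ℕ} {l : Filter ℝ} {E S : ℝ → Matrix (Fin p) (Fin p) ℝ}
    (hS : Tendsto S l (nhds 0)) (hu : ∀ x, IsUnit (S x).det)
    (hES : Tendsto (fun x => E x * S x) l (nhds 1)) : Tendsto (fun x => (E x)⁻¹) l (nhds 0) := by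
  have h := hS.mul (inv_tendsto_one hES)
  rw [zero_mul] at h
  refine h.congr fun x => ?_
  rw [Matrix.mul_inv_rev, ← mul_assoc, Matrix.mul_nonsing_inv _ (hu x), one_mul]

end normed

theorem prod_deriv_entry {p : ℕ} (A K : Matrix (Fin p) (Fin p) ℝ) (t : ℝ) (i j : Fin p) :
    HasDerivAt (fun s : ℝ => (NormedSpace.exp (-(s • A)) * K * NormedSpace.exp (-(s • A))) i j)
      ((-(A * (NormedSpace.exp (-(t • A)) * K * NormedSpace.exp (-(t • A))) +
        (NormedSpace.exp (-(t • A)) * K * NormedSpace.exp (-(t • A))) * A)) i j) t := by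
  have := (hasDerivAt_pi.1 ((hasDerivAt_pi.1 (prod_deriv A K t)) i)) j
  exact this


/-- exponential decay at infinity -/
def ExpDec {E : Type*} [NormedAddCommGroup E] (f : ℝ → E) : Prop :=
  ∃ δ : ℝ, 0 < δ ∧ f =O[atTop] fun s : ℝ => Real.exp (-δ * s)

theorem exp_isBigO_mono {a b : ℝ} (h : a ≤ b) :
    (fun s : ℝ => Real.exp (-b * s)) =O[atTop] fun s : ℝ => Real.exp (-a * s) := by
  apply Asymptotics.IsBigO.of_bound 1
  filter_upwards [eventually_ge_atTop (0:ℝ)] with s hs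
  rw [Real.norm_of_nonneg (Real.exp_pos _).le, Real.norm_of_nonneg (Real.exp_pos _).le, one_mul]
  apply Real.exp_le_exp.2
  nlinarith

theorem ExpDec.add {E : Type*} [NormedAddCommGroup E] {f g : ℝ → E} (hf : ExpDec f)
    (hg : ExpDec g) : ExpDec (fun s => f s + g s) := by
  obtain ⟨a, ha, hf⟩ := hf
  obtain ⟨b, hb, hg⟩ := hg
  exact ⟨min a b, lt_min ha hb, (hf.trans (exp_isBigO_mono (min_le_left a b))).add
    (hg.trans (exp_isBigO_mono (min_le_right a b)))⟩

theorem ExpDec.zero {E : Type*} [NormedAddCommGroup E] : ExpDec (fun _ : ℝ => (0 : E)) :=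
  ⟨1, one_pos, Asymptotics.isBigO_zero _ _⟩

theorem ExpDec.sum {E ι : Type*} [NormedAddCommGroup E] (s : Finset ι) {f : ι → ℝ → E}
    (hf : ∀ i ∈ s, ExpDec (f i)) : ExpDec (fun x => ∑ i ∈ s, f i x) := by
  classical
  induction s using Finset.induction_on with
  | empty => simpa using ExpDec.zero
  | insert a s ha ih =>
    simp only [Finset.sum_insert ha]
    exact (hf a (by simp)).add (ih fun i hi => hf i (by simp [hi]))

theorem ExpDec.mul {f g : ℝ → ℝ} (hf : ExpDec f) (hg : ExpDec g) :
    ExpDec (fun s => f s * g s) := by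
  obtain ⟨a, ha, hf⟩ := hf
  obtain ⟨b, hb, hg⟩ := hg
  refine ⟨a + b, by positivity, (hf.mul hg).congr_right fun s => ?_⟩
  rw [← Real.exp_add]; ring_nf

theorem ExpDec.mul_const {f : ℝ → ℝ} (hf : ExpDec f) (c : ℝ) :
    ExpDec (fun s => f s * c) := by
  obtain ⟨a, ha, hf⟩ := hf
  refine ⟨a, ha, ?_⟩
  simpa [mul_comm] using hf.const_mul_left c

theorem ExpDec.tendsto {E : Type*} [NormedAddCommGroup E] {f : ℝ → E} (hf : ExpDec f) :
    Tendsto f atTop (nhds 0) := by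
  obtain ⟨a, ha, hf⟩ := hf
  refine hf.trans_tendsto ?_
  apply Real.tendsto_exp_atBot.comp
  exact tendsto_id.const_mul_atTop_of_neg (by linarith)

theorem ExpDec.integrable {f : ℝ → ℝ} (hf : ExpDec f) (hc : Continuous f) :
    IntegrableOn f (Set.Ioi 0) := by
  obtain ⟨a, ha, hf⟩ := hf
  exact integrable_of_isBigO_exp_neg ha hc.continuousOn hf

theorem poly_expDec {E : Type*} [NormedAddCommGroup E] [NormedSpace ℂ E] (μ : ℂ) (hμ : 0 < μ.re)
    (k : ℕ) (c : ℂ) (v : E) :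
    ExpDec (fun s : ℝ => (Complex.exp (-(s:ℂ) * μ) * (c * (-(s:ℂ)) ^ k)) • v) := by
  refine ⟨μ.re / 2, by positivity, ?_⟩
  have h1 : (fun s : ℝ => s ^ k) =O[atTop] fun s : ℝ => Real.exp (μ.re / 2 * s) :=
    (isLittleO_pow_exp_pos_mul_atTop k (by positivity)).isBigO
  have h2 : (fun s : ℝ => (Complex.exp (-(s:ℂ) * μ) * (c * (-(s:ℂ)) ^ k)) • v) =O[atTop]
      fun s : ℝ => Real.exp (-μ.re * s) * s ^ k := by
    apply Asymptotics.IsBigO.of_bound (‖c‖ * ‖v‖)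
    filter_upwards [eventually_ge_atTop (0:ℝ)] with s hs
    rw [norm_smul, norm_mul, norm_mul, norm_pow, norm_neg, Complex.norm_exp, norm_mul, norm_pow]
    simp only [Complex.norm_real, Real.norm_eq_abs, Real.abs_exp]
    have : (-(s:ℂ) * μ).re = -μ.re * s := by simp [mul_comm]
    rw [this]
    apply le_of_eq; ring
  refine h2.trans ?_
  refine ((Asymptotics.isBigO_refl (fun s : ℝ => Real.exp (-μ.re * s)) atTop).mul h1).congr_right
    fun s => ?_
  rw [← Real.exp_add]; ring_nf

theorem gen_expDec {p : ℕ} (M : Matrix (Fin p) (Fin p) ℂ) (μ : ℂ) (hμ : 0 < μ.re) (k : ℕ)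
    (v : Fin p → ℂ) (hv : ((M - μ • 1) ^ k) *ᵥ v = 0) :
    ExpDec (fun s : ℝ => NormedSpace.exp ((-(s:ℂ)) • M) *ᵥ v) := by
  have key : ∀ s : ℝ, NormedSpace.exp ((-(s:ℂ)) • M) *ᵥ v =
      ∑ j ∈ Finset.range k, (Complex.exp (-(s:ℂ) * μ) * ((j.factorial : ℂ)⁻¹ * (-(s:ℂ)) ^ j)) •
        (((M - μ • 1) ^ j) *ᵥ v) := by
    intro s
    set N := M - μ • (1 : Matrix (Fin p) (Fin p) ℂ) with hN
    have e1 : (-(s:ℂ)) • M = Matrix.diagonal (fun _ => -(s:ℂ) * μ) + (-(s:ℂ)) • N := by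
      rw [hN, smul_sub, smul_smul, ← Matrix.smul_one_eq_diagonal]; abel
    have hc : Commute (Matrix.diagonal (fun _ : Fin p => -(s:ℂ) * μ)) ((-(s:ℂ)) • N) := by
      rw [← Matrix.smul_one_eq_diagonal]
      exact (Commute.one_left _).smul_left _
    rw [e1, Matrix.exp_add_of_commute _ _ hc, Matrix.exp_diagonal, ← Matrix.mulVec_mulVec]
    have e2 : NormedSpace.exp ((-(s:ℂ)) • N) *ᵥ v =
        ∑ j ∈ Finset.range k, ((j.factorial : ℂ)⁻¹ * (-(s:ℂ)) ^ j) • ((N ^ j) *ᵥ v) := by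
      have hs := mat_hasSum ((-(s:ℂ)) • N)
      have hs2 := hs.map (Matrix.mulVec.addMonoidHomLeft v)
        (by exact Continuous.matrix_mulVec continuous_id continuous_const)
      have hs3 : HasSum (fun j : ℕ => ((j.factorial : ℂ)⁻¹ * (-(s:ℂ)) ^ j) • ((N ^ j) *ᵥ v))
          (NormedSpace.exp ((-(s:ℂ)) • N) *ᵥ v) := by
        convert! (show HasSum _ (NormedSpace.exp ((-(s:ℂ)) • N) *ᵥ v) from hs2) using 1
        funext j
        show _ = (((j.factorial : ℂ)⁻¹) • ((-(s:ℂ)) • N) ^ j) *ᵥ v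
        rw [smul_pow, smul_smul, Matrix.smul_mulVec]
      refine hs3.unique (hasSum_sum_of_ne_finset_zero ?_)
      intro j hj
      have hj : k ≤ j := by simpa using hj
      have : N ^ j *ᵥ v = 0 := by
        rw [← Nat.sub_add_cancel hj, pow_add, ← Matrix.mulVec_mulVec, hv, Matrix.mulVec_zero]
      rw [this, smul_zero]
    rw [e2]
    funext i
    rw [Matrix.mulVec_diagonal]
    simp only [Finset.sum_apply, Pi.smul_apply, smul_eq_mul, Finset.mul_sum,
      mul_assoc, Complex.exp_eq_exp_ℂ, Pi.coe_exp]
  simp only [key]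
  exact ExpDec.sum _ fun j _ => poly_expDec μ hμ j _ _

theorem all_expDec {p : ℕ} (M : Matrix (Fin p) (Fin p) ℂ)
    (hM : ∀ μ ∈ spectrum ℂ M, 0 < μ.re) (v : Fin p → ℂ) :
    ExpDec (fun s : ℝ => NormedSpace.exp ((-(s:ℂ)) • M) *ᵥ v) := by
  let S : Submodule ℂ (Fin p → ℂ) :=
    { carrier := {v | ExpDec (fun s : ℝ => NormedSpace.exp ((-(s:ℂ)) • M) *ᵥ v)}
      add_mem' := by
        intro a b ha hb
        simp only [Set.mem_ofPred_eq, Matrix.mulVec_add] at *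
        exact ha.add hb
      zero_mem' := by
        simp only [Set.mem_ofPred_eq, Matrix.mulVec_zero]
        exact ExpDec.zero
      smul_mem' := by
        intro c a ha
        simp only [Set.mem_ofPred_eq, Matrix.mulVec_smul] at *
        obtain ⟨δ, h, h'⟩ := ha
        exact ⟨δ, h, h'.const_smul_left c⟩ }
  have hS : (⊤ : Submodule ℂ (Fin p → ℂ)) ≤ S := by
    rw [← Module.End.iSup_maxGenEigenspace_eq_top (Matrix.toLin' M)]
    refine iSup_le fun μ w hw => ?_
    by_cases hμ : μ ∈ spectrum ℂ M
    · obtain ⟨k, hk⟩ := (Module.End.mem_maxGenEigenspace _ _ _).1 hw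
      refine gen_expDec M μ (hM μ hμ) k w ?_
      have : (Matrix.toLin' M - μ • (1 : Module.End ℂ (Fin p → ℂ))) ^ k
          = Matrix.toLin' ((M - μ • 1) ^ k) := by
        rw [Matrix.toLin'_pow, map_sub, map_smul, Matrix.toLin'_one]; rfl
      rw [this] at hk
      exact hk
    · have h0 : Module.End.maxGenEigenspace (Matrix.toLin' M) μ = ⊥ := by
        by_contra hne
        apply hμ
        rw [← Matrix.spectrum_toLin']
        apply Module.End.hasEigenvalue_iff_mem_spectrum.1
        exact Module.End.HasUnifEigenvalue.lt zero_lt_one hne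
      rw [h0] at hw
      rw [(Submodule.mem_bot ℂ).1 hw]
      exact S.zero_mem
  exact hS (Submodule.mem_top (x := v))

theorem real_expDec {p : ℕ} (A : Matrix (Fin p) (Fin p) ℝ) (hA : EigPos A) (i j : Fin p) :
    ExpDec (fun s : ℝ => NormedSpace.exp (-(s • A)) i j) := by
  obtain ⟨δ, h, h'⟩ := all_expDec _ hA (Pi.single j 1)
  refine ⟨δ, h, ?_⟩
  have h2 := (Asymptotics.isBigO_pi.1 h') i
  refine (Asymptotics.IsBigO.congr_left h2.norm_left fun s => ?_).of_norm_left
  have : (-(s:ℂ)) • A.map Complex.ofReal = (-(s • A)).map Complex.ofReal := by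
    ext a b; simp
  rw [this, ← mat_map_exp, Matrix.mulVec_single_one]
  simp

theorem prod_expDec {p : ℕ} (A K : Matrix (Fin p) (Fin p) ℝ) (hA : EigPos A) (i j : Fin p) :
    ExpDec (fun s : ℝ => (NormedSpace.exp (-(s • A)) * K * NormedSpace.exp (-(s • A))) i j) := by
  simp only [Matrix.mul_apply]
  exact ExpDec.sum _ fun a _ => (ExpDec.sum _ fun b _ => (real_expDec A hA i b).mul_const _).mul
    (real_expDec A hA a j)

theorem prod_cont {p : ℕ} (A K : Matrix (Fin p) (Fin p) ℝ) (i j : Fin p) :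
    Continuous (fun s : ℝ => (NormedSpace.exp (-(s • A)) * K * NormedSpace.exp (-(s • A))) i j) :=
  continuous_iff_continuousAt.2 fun t => (prod_deriv_entry A K t i j).continuousAt

theorem sylvester {p : ℕ} (A : Matrix (Fin p) (Fin p) ℝ)
    (B : Matrix (Fin p) (Fin 1) ℝ) (C : Matrix (Fin 1) (Fin p) ℝ) (hA : EigPos A) :
    A * Pmat A B C + Pmat A B C * A = B * C := by
  set G : ℝ → Matrix (Fin p) (Fin p) ℝ := fun s =>
    NormedSpace.exp (-(s • A)) * (B * C) * NormedSpace.exp (-(s • A)) with hG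
  have hP : ∀ i j, Pmat A B C i j = ∫ s in Set.Ioi (0:ℝ), G s i j := by
    intro i j
    simp only [Pmat, mexp_eq, Matrix.of_apply, hG]
  have hint : ∀ i j, IntegrableOn (fun s => G s i j) (Set.Ioi 0) := fun i j =>
    (prod_expDec A (B * C) hA i j).integrable (prod_cont A (B * C) i j)
  ext i j
  have hi1 : ∀ k ∈ Finset.univ, Integrable (fun s => A i k * G s k j)
      (volume.restrict (Set.Ioi 0)) := fun k _ => (hint k j).const_mul _
  have hi2 : ∀ k ∈ Finset.univ, Integrable (fun s => G s i k * A k j)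
      (volume.restrict (Set.Ioi 0)) := fun k _ => (hint i k).mul_const _
  have hI : ∫ s in Set.Ioi (0:ℝ), (A * G s + G s * A) i j =
      (A * Pmat A B C + Pmat A B C * A) i j := by
    simp only [Matrix.add_apply, Matrix.mul_apply, hP]
    rw [integral_add (integrable_finset_sum _ hi1) (integrable_finset_sum _ hi2),
      integral_finset_sum _ hi1, integral_finset_sum _ hi2]
    simp only [integral_const_mul, integral_mul_const]
  have hint' : IntegrableOn (fun s => (-(A * G s + G s * A)) i j) (Set.Ioi 0) := by
    simp only [Matrix.neg_apply, Matrix.add_apply, Matrix.mul_apply]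
    exact ((integrable_finset_sum _ hi1).add (integrable_finset_sum _ hi2)).neg
  have := integral_Ioi_of_hasDerivAt_of_tendsto' (a := 0)
    (fun t _ => prod_deriv_entry A (B * C) t i j) hint' (prod_expDec A (B * C) hA i j).tendsto
  rw [← hI]
  have h0 : (NormedSpace.exp (-((0:ℝ) • A)) * (B * C) * NormedSpace.exp (-((0:ℝ) • A))) i j
      = (B * C) i j := by
    simp [NormedSpace.exp_zero]
  rw [h0] at this
  simp only [Matrix.neg_apply] at this
  rw [integral_neg] at this
  have h3 : ∫ s in Set.Ioi (0:ℝ), (A * G s + G s * A) i j = (B * C) i j := by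
    linarith
  exact h3

theorem P_unit {p : ℕ} (A P : Matrix (Fin p) (Fin p) ℝ)
    (B : Matrix (Fin p) (Fin 1) ℝ) (C : Matrix (Fin 1) (Fin p) ℝ)
    (hobs : Observable A C) (hctrl : Controllable A B)
    (hP : A * P + P * A = B * C) : IsUnit P.det := by
  have hv0 : ∀ v, P *ᵥ v = 0 → P *ᵥ (A *ᵥ v) = B *ᵥ (C *ᵥ v) := by
    intro v hv
    have := congrArg (fun M => M *ᵥ v) hP
    simpa [Matrix.add_mulVec, ← Matrix.mulVec_mulVec, hv] using this
  by_cases hK : ∀ v, P *ᵥ v = 0 → C *ᵥ v = 0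
  · -- kernel is invariant, hence trivial
    have hinv : ∀ r : ℕ, ∀ v, P *ᵥ v = 0 → P *ᵥ (A ^ r *ᵥ v) = 0 := by
      intro r
      induction r with
      | zero => intro v hv; simpa using hv
      | succ n ih =>
        intro v hv
        rw [pow_succ, ← Matrix.mulVec_mulVec]
        apply ih
        rw [hv0 v hv, hK v hv, Matrix.mulVec_zero]
    rw [isUnit_iff_ne_zero]
    intro hdet
    obtain ⟨v, hv, hv'⟩ := Matrix.exists_mulVec_eq_zero_iff.2 hdet
    apply hv
    apply hobs
    intro r
    rw [← Matrix.mulVec_mulVec]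
    exact hK _ (hinv r v hv')
  · push Not at hK
    obtain ⟨v, hv, hCv⟩ := hK
    -- left kernel: w P = 0 implies w B = 0
    have hwB : ∀ w, w ᵥ* P = 0 → w ᵥ* B = 0 := by
      intro w hw
      have h1 : w ᵥ* (B * C) = (w ᵥ* A) ᵥ* P := by
        rw [← hP, Matrix.vecMul_add, ← Matrix.vecMul_vecMul, ← Matrix.vecMul_vecMul, hw]
        simp
      have h2 : w ⬝ᵥ (B *ᵥ (C *ᵥ v)) = 0 := by
        rw [← hv0 v hv, Matrix.dotProduct_mulVec, hw, zero_dotProduct]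
      rw [Matrix.dotProduct_mulVec] at h2
      simp only [dotProduct, Finset.univ_unique, Finset.sum_singleton] at h2
      funext k
      have hk : k = default := Subsingleton.elim _ _
      subst hk
      rcases mul_eq_zero.1 h2 with h | h
      · exact h
      · exfalso; apply hCv; funext k
        rw [Subsingleton.elim k default]; exact h
    have hwA : ∀ w, w ᵥ* P = 0 → (w ᵥ* A) ᵥ* P = 0 := by
      intro w hw
      have h1 : w ᵥ* (B * C) = (w ᵥ* A) ᵥ* P := by
        rw [← hP, Matrix.vecMul_add, ← Matrix.vecMul_vecMul, ← Matrix.vecMul_vecMul, hw]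
        simp
      rw [← h1, ← Matrix.vecMul_vecMul, hwB w hw, Matrix.zero_vecMul]
    have hinv : ∀ r : ℕ, ∀ w, w ᵥ* P = 0 → (w ᵥ* A ^ r) ᵥ* P = 0 := by
      intro r
      induction r with
      | zero => intro w hw; simpa using hw
      | succ n ih =>
        intro w hw
        rw [pow_succ, ← Matrix.vecMul_vecMul]
        exact hwA _ (ih w hw)
    rw [isUnit_iff_ne_zero]
    intro hdet
    obtain ⟨w, hw, hw'⟩ := Matrix.exists_vecMul_eq_zero_iff.2 hdet
    apply hw
    apply hctrl
    intro r
    rw [← Matrix.mulVec_mulVec, ← Matrix.transpose_pow, Matrix.mulVec_transpose,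
      Matrix.mulVec_transpose]
    exact hwB _ (hinv r w hw')

theorem exp_tendsto {p : ℕ} (A : Matrix (Fin p) (Fin p) ℝ) (hA : EigPos A) :
    Tendsto (fun s : ℝ => NormedSpace.exp (-(s • A))) atTop (nhds 0) := by
  refine tendsto_pi_nhds.2 fun i => tendsto_pi_nhds.2 fun j => ?_
  exact (real_expDec A hA i j).tendsto

theorem exp_split {p : ℕ} (A : Matrix (Fin p) (Fin p) ℝ) (a b : ℝ) :
    NormedSpace.exp (a • A + b • A ^ 3) = NormedSpace.exp (a • A) * NormedSpace.exp (b • A ^ 3) :=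
  Matrix.exp_add_of_commute _ _ ((((Commute.refl A).pow_right 3).smul_right b).smul_left a)

theorem statement11 {p : ℕ} (hp : 0 < p) (A : Matrix (Fin p) (Fin p) ℝ)
    (B : Matrix (Fin p) (Fin 1) ℝ) (C : Matrix (Fin 1) (Fin p) ℝ)
    (hA : EigPos A) (hobs : Observable A C) (hctrl : Controllable A B) :
    ∀ t : ℝ,
      Tendsto (fun x : ℝ => (Emat A B C x t)⁻¹) atTop
        (nhds (0 : Matrix (Fin p) (Fin p) ℝ)) ∧
      Tendsto (fun x : ℝ => (Emat A B C x t)⁻¹) atBot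
        (nhds (0 : Matrix (Fin p) (Fin p) ℝ)) := by
  intro t
  have hP := P_unit A (Pmat A B C) B C hobs hctrl (sylvester A B C hA)
  set P := Pmat A B C with hPdef
  have hE : ∀ x, Emat A B C x t = NormedSpace.exp ((2 * x) • A - (8 * t) • A ^ 3) +
      P * NormedSpace.exp (-((2 * x) • A - (8 * t) • A ^ 3)) * P := by
    intro x
    rw [Emat, mexp_eq, mexp_eq, neg_sub', sub_neg_eq_add]
  have hu : ∀ M : Matrix (Fin p) (Fin p) ℝ, IsUnit (NormedSpace.exp M).det := fun M =>
    (Matrix.isUnit_iff_isUnit_det _).1 (Matrix.isUnit_exp M)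
  have hm : ∀ M : Matrix (Fin p) (Fin p) ℝ, NormedSpace.exp M * NormedSpace.exp (-M) = 1 := by
    intro M
    rw [Matrix.exp_neg, Matrix.mul_nonsing_inv _ (hu M)]
  have hm' : ∀ M : Matrix (Fin p) (Fin p) ℝ, NormedSpace.exp (-M) * NormedSpace.exp M = 1 := by
    intro M
    rw [Matrix.exp_neg, Matrix.nonsing_inv_mul _ (hu M)]
  constructor
  · have hS : Tendsto (fun x : ℝ => NormedSpace.exp (-((2 * x) • A - (8 * t) • A ^ 3))) atTop
        (nhds 0) := by
      have h1 : Tendsto (fun x : ℝ => 2 * x) atTop atTop :=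
        tendsto_id.const_mul_atTop (by norm_num)
      have h2 := ((exp_tendsto A hA).comp h1).mul_const (NormedSpace.exp ((8 * t) • A ^ 3))
      rw [zero_mul] at h2
      refine h2.congr fun x => ?_
      rw [neg_sub', sub_neg_eq_add, ← neg_smul, exp_split, neg_smul]
      rfl
    refine lim_lemma hS (fun x => hu _) ?_
    have h := ((hS.const_mul P).mul_const P).mul hS
    have h' := h.const_add (1 : Matrix (Fin p) (Fin p) ℝ)
    simp only [mul_zero, add_zero] at h'
    refine h'.congr fun x => ?_
    rw [hE, add_mul, hm]
  · have hS : Tendsto (fun x : ℝ => NormedSpace.exp ((2 * x) • A - (8 * t) • A ^ 3)) atBot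
        (nhds 0) := by
      have h1 : Tendsto (fun x : ℝ => (-2) * x) atBot atTop :=
        tendsto_id.const_mul_atBot_of_neg (by norm_num)
      have h2 := ((exp_tendsto A hA).comp h1).mul_const (NormedSpace.exp ((-(8 * t)) • A ^ 3))
      rw [zero_mul] at h2
      refine h2.congr fun x => ?_
      rw [sub_eq_add_neg, ← neg_smul, exp_split]
      simp only [Function.comp, ← neg_smul]
      ring_nf
    have hS2 := (hS.const_mul P⁻¹).mul_const P⁻¹
    simp only [mul_zero, zero_mul] at hS2
    refine lim_lemma hS2 (fun x => ?_) ?_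
    · rw [Matrix.det_mul, Matrix.det_mul]
      exact ((Matrix.isUnit_nonsing_inv_det _ hP).mul (hu _)).mul
        (Matrix.isUnit_nonsing_inv_det _ hP)
    have h' := (hS.mul hS2).add_const (1 : Matrix (Fin p) (Fin p) ℝ)
    simp only [mul_zero, zero_add] at h'
    refine h'.congr fun x => ?_
    rw [hE, add_mul]
    congr 1
    symm
    set W := (2 * x) • A - (8 * t) • A ^ 3
    calc P * NormedSpace.exp (-W) * P * (P⁻¹ * NormedSpace.exp W * P⁻¹)
        = P * (NormedSpace.exp (-W) * ((P * P⁻¹) * NormedSpace.exp W)) * P⁻¹ := by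
          simp only [mul_assoc]
      _ = 1 := by
          rw [Matrix.mul_nonsing_inv _ hP, one_mul, hm', mul_one, Matrix.mul_nonsing_inv _ hP]
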